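/- Under the Algorithm 1 setup, for every agent i ∈ {1,…,n} and every t ∈ ℕ₊, the iterates of Algorithm 1 satisfy ‖q̃_{i,t+1} − q̄_t‖ ≤ nτB₁ Σ_{s=1}^{t−1} γ_{s+1} λ^{t−1−s}, where τ = (1 − w/(2n²))^{−2}, λ = (1 − w/(2n²))^{1/ι}, and B₁ = 2F + G·d(X). -/

import Mathlib

open scoped RealInnerProductSpace

noncomputable section

/-- Bregman divergence generated by `ψ` with gradient map `ψ'`. -/
def breg {d : ℕ} (ψ : EuclideanSpace ℝ (Fin d) → ℝ)
    (ψ' : EuclideanSpace ℝ (Fin d) → EuclideanSpace ℝ (Fin d))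
    (x y : EuclideanSpace ℝ (Fin d)) : ℝ :=
  ψ x - ψ y - ⟪ψ' y, x - y⟫

/-- Componentwise positive part `[v]₊`. -/
def posPart {d : ℕ} (v : EuclideanSpace ℝ (Fin d)) : EuclideanSpace ℝ (Fin d) :=
  (WithLp.equiv 2 (Fin d → ℝ)).symm fun j => max (v j) 0

/-- Build a Euclidean vector from a coordinate function. -/
def vecOf {d : ℕ} (v : Fin d → ℝ) : EuclideanSpace ℝ (Fin d) :=
  (WithLp.equiv 2 (Fin d → ℝ)).symm v

/-- Stack a family of per-agent vectors into the Euclidean product space. -/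
def stack {n : ℕ} {p : Fin n → ℕ} (y : ∀ i, EuclideanSpace ℝ (Fin (p i))) :
    PiLp 2 (fun i => EuclideanSpace ℝ (Fin (p i))) :=
  (WithLp.equiv 2 (∀ i, EuclideanSpace ℝ (Fin (p i)))).symm y

/-- The setup and iterates of Algorithm 1 (distributed online primal-dual
dynamic mirror descent) of the paper. -/
structure Alg (n m : ℕ) (p : Fin n → ℕ) where
  hn : 0 < n
  hm : 0 < m
  X : ∀ i : Fin n, Set (EuclideanSpace ℝ (Fin (p i)))
  hXconvex : ∀ i, Convex ℝ (X i)
  hXcompact : ∀ i, IsCompact (X i)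
  hXnonempty : ∀ i, (X i).Nonempty
  dX : ℝ
  hdX : 0 < dX
  hdiam : ∀ u v : PiLp 2 (fun i => EuclideanSpace ℝ (Fin (p i))),
    (∀ i, u i ∈ X i) → (∀ i, v i ∈ X i) → ‖u - v‖ ≤ dX
  f : ℕ → ∀ i : Fin n, EuclideanSpace ℝ (Fin (p i)) → ℝ
  r : ℕ → ∀ i : Fin n, EuclideanSpace ℝ (Fin (p i)) → ℝ
  g : ℕ → ∀ i : Fin n, EuclideanSpace ℝ (Fin (p i)) → EuclideanSpace ℝ (Fin m)
  hf0 : ∀ i z, f 0 i z = 0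
  hr0 : ∀ i z, r 0 i z = 0
  hg0 : ∀ i z, g 0 i z = 0
  hfconvex : ∀ t i, ConvexOn ℝ (X i) (f t i)
  hrconvex : ∀ t i, ConvexOn ℝ (X i) (r t i)
  hgconvex : ∀ t i (j : Fin m), ConvexOn ℝ (X i) (fun z => g t i z j)
  F : ℝ
  hF : 0 < F
  G : ℝ
  hG : 0 < G
  hfbound : ∀ t i, ∀ z ∈ X i, |f t i z| ≤ F
  hrbound : ∀ t i, ∀ z ∈ X i, |r t i z| ≤ F
  hgbound : ∀ t i, ∀ z ∈ X i, ‖g t i z‖ ≤ F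
  Gf : ℕ → ∀ i : Fin n, EuclideanSpace ℝ (Fin (p i)) → EuclideanSpace ℝ (Fin (p i))
  Gr : ℕ → ∀ i : Fin n, EuclideanSpace ℝ (Fin (p i)) → EuclideanSpace ℝ (Fin (p i))
  Gg : ℕ → ∀ i : Fin n, EuclideanSpace ℝ (Fin (p i)) → Fin m → EuclideanSpace ℝ (Fin (p i))
  hGfsub : ∀ t i, ∀ z ∈ X i, ∀ u ∈ X i, f t i z + ⟪Gf t i z, u - z⟫ ≤ f t i u
  hGrsub : ∀ t i, ∀ z ∈ X i, ∀ u ∈ X i, r t i z + ⟪Gr t i z, u - z⟫ ≤ r t i u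
  hGgsub : ∀ t i, ∀ z ∈ X i, ∀ (j : Fin m), ∀ u ∈ X i,
    g t i z j + ⟪Gg t i z j, u - z⟫ ≤ g t i u j
  hGfbound : ∀ t i, ∀ z ∈ X i, ‖Gf t i z‖ ≤ G
  hGrbound : ∀ t i, ∀ z ∈ X i, ‖Gr t i z‖ ≤ G
  hGgbound : ∀ t i, ∀ z ∈ X i, ∀ v, ‖vecOf (fun j => ⟪Gg t i z j, v⟫)‖ ≤ G * ‖v‖
  W : ℕ → Matrix (Fin n) (Fin n) ℝ
  hWnonneg : ∀ t i j, 0 ≤ W t i j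
  hWrow : ∀ t i, ∑ j, W t i j = 1
  hWcol : ∀ t j, ∑ i, W t i j = 1
  w : ℝ
  hw0 : 0 < w
  hw1 : w < 1
  hWdiag : ∀ t i, w ≤ W t i i
  hWpos : ∀ t i j, 0 < W t i j → w ≤ W t i j
  iota : ℕ
  hiota : 0 < iota
  hconn : ∀ (t : ℕ) (c d : Fin n),
    Relation.ReflTransGen (fun u v : Fin n => ∃ l < iota, 0 < W (t + l) v u) c d
  ψ : ∀ i : Fin n, EuclideanSpace ℝ (Fin (p i)) → ℝ
  ψ' : ∀ i : Fin n, EuclideanSpace ℝ (Fin (p i)) → EuclideanSpace ℝ (Fin (p i))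
  hψgrad : ∀ i z, HasGradientAt (ψ i) (ψ' i z) z
  σ : Fin n → ℝ
  hσ : ∀ i, 0 < σ i
  hψstrong : ∀ i, ∀ z ∈ X i, ∀ u ∈ X i,
    ψ i u + ⟪ψ' i u, z - u⟫ + σ i / 2 * ‖z - u‖ ^ 2 ≤ ψ i z
  K : ℝ
  hK : 0 < K
  hbregLip : ∀ i, ∀ z₁ ∈ X i, ∀ z₂ ∈ X i, ∀ u ∈ X i,
    |breg (ψ i) (ψ' i) z₁ u - breg (ψ i) (ψ' i) z₂ u| ≤ K * ‖z₁ - z₂‖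
  Φ : ℕ → ∀ i : Fin n, EuclideanSpace ℝ (Fin (p i)) → EuclideanSpace ℝ (Fin (p i))
  hΦmaps : ∀ t i, ∀ z ∈ X i, Φ t i z ∈ X i
  hΦcontract : ∀ t i, ∀ z ∈ X i, ∀ u ∈ X i,
    breg (ψ i) (ψ' i) (Φ t i z) (Φ t i u) ≤ breg (ψ i) (ψ' i) z u
  α : ℕ → ℝ
  β : ℕ → ℝ
  γ : ℕ → ℝ
  hαpos : ∀ t, 1 ≤ t → 0 < α t
  hβpos : ∀ t, 1 ≤ t → 0 < β t
  hγpos : ∀ t, 1 ≤ t → 0 < γ t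
  hαanti : ∀ s t, 1 ≤ s → s ≤ t → α t ≤ α s
  hβanti : ∀ s t, 1 ≤ s → s ≤ t → β t ≤ β s
  hγanti : ∀ s t, 1 ≤ s → s ≤ t → γ t ≤ γ s
  x : ℕ → ∀ i : Fin n, EuclideanSpace ℝ (Fin (p i))
  xtil : ℕ → ∀ i : Fin n, EuclideanSpace ℝ (Fin (p i))
  q : ℕ → Fin n → EuclideanSpace ℝ (Fin m)
  qtil : ℕ → Fin n → EuclideanSpace ℝ (Fin m)
  a : ℕ → ∀ i : Fin n, EuclideanSpace ℝ (Fin (p i))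
  b : ℕ → Fin n → EuclideanSpace ℝ (Fin m)
  hx0 : ∀ i, x 0 i ∈ X i
  hq0 : ∀ i, q 0 i = 0
  hqtil : ∀ t, 1 ≤ t → ∀ i, qtil t i = ∑ j, W (t - 1) i j • q (t - 1) j
  ha : ∀ t, 1 ≤ t → ∀ i,
    a t i = Gf (t - 1) i (x (t - 1) i) + ∑ j, qtil t i j • Gg (t - 1) i (x (t - 1) i) j
  hxtilmem : ∀ t, 1 ≤ t → ∀ i, xtil t i ∈ X i
  hxtilmin : ∀ t, 1 ≤ t → ∀ i, ∀ z ∈ X i,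
    α t * ⟪xtil t i, a t i⟫ + α t * r (t - 1) i (xtil t i)
        + breg (ψ i) (ψ' i) (xtil t i) (x (t - 1) i)
      ≤ α t * ⟪z, a t i⟫ + α t * r (t - 1) i z + breg (ψ i) (ψ' i) z (x (t - 1) i)
  hb : ∀ t, 1 ≤ t → ∀ i,
    b t i = vecOf (fun j => ⟪Gg (t - 1) i (x (t - 1) i) j, xtil t i - x (t - 1) i⟫)
      + g (t - 1) i (x (t - 1) i)
  hq : ∀ t, 1 ≤ t → ∀ i,
    q t i = posPart (qtil t i + γ t • (b t i - β t • qtil t i))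
  hx : ∀ t, 1 ≤ t → ∀ i, x t i = Φ t i (xtil t i)

namespace Alg

variable {n m : ℕ} {p : Fin n → ℕ}

/-- Average dual variable `q̄_t`. -/
def qbar (S : Alg n m p) (t : ℕ) : EuclideanSpace ℝ (Fin m) :=
  (n : ℝ)⁻¹ • ∑ i, S.q t i

/-- `σ̲ = min_i σ_i`. -/
def sigmin (S : Alg n m p) : ℝ :=
  Finset.univ.inf' (Finset.univ_nonempty_iff.mpr ⟨⟨0, S.hn⟩⟩) S.σ

/-- `τ = (1 − w/(2n²))⁻²`. -/
def tau (S : Alg n m p) : ℝ := ((1 - S.w / (2 * (n : ℝ) ^ 2)) ^ 2)⁻¹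

/-- `λ = (1 − w/(2n²))^{1/ι}`. -/
def lam (S : Alg n m p) : ℝ := (1 - S.w / (2 * (n : ℝ) ^ 2)) ^ ((S.iota : ℝ))⁻¹

/-- `B₁ = 2F + G d(X)`. -/
def B1 (S : Alg n m p) : ℝ := 2 * S.F + S.G * S.dX

/-- `E₁(t) = n²τB₁F Σ_{s=1}^{t−1} γ_{s+1} λ^{t−1−s}`. -/
def E1 (S : Alg n m p) (t : ℕ) : ℝ :=
  (n : ℝ) ^ 2 * S.tau * S.B1 * S.F *
    ∑ s ∈ Finset.Icc 1 (t - 1), S.γ (s + 1) * S.lam ^ (t - 1 - s)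

/-- Global objective `f_t(y) = Σ_i (f_{i,t}(y_i) + r_{i,t}(y_i))`. -/
def fsum (S : Alg n m p) (t : ℕ) (y : ∀ i, EuclideanSpace ℝ (Fin (p i))) : ℝ :=
  ∑ i, (S.f t i (y i) + S.r t i (y i))

/-- Global constraint `g_t(y) = Σ_i g_{i,t}(y_i)`. -/
def gsum (S : Alg n m p) (t : ℕ) (y : ∀ i, EuclideanSpace ℝ (Fin (p i))) :
    EuclideanSpace ℝ (Fin m) :=
  ∑ i, S.g t i (y i)

/-- Regret against a comparator sequence. -/
def reg (S : Alg n m p) (T : ℕ) (y : ℕ → ∀ i, EuclideanSpace ℝ (Fin (p i))) : ℝ :=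
  ∑ t ∈ Finset.Icc 1 T, S.fsum t (S.x t) - ∑ t ∈ Finset.Icc 1 T, S.fsum t (y t)

/-- Feasibility of a comparator sequence on `1..T`. -/
def Feasible (S : Alg n m p) (T : ℕ) (y : ℕ → ∀ i, EuclideanSpace ℝ (Fin (p i))) : Prop :=
  ∀ t ∈ Finset.Icc 1 T, (∀ i, y t i ∈ S.X i) ∧ ∀ j, S.gsum t (y t) j ≤ 0

/-- Accumulated dynamic variation `V_Φ(y_T)`. -/
def VPhi (S : Alg n m p) (T : ℕ) (y : ℕ → ∀ i, EuclideanSpace ℝ (Fin (p i))) : ℝ :=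
  ∑ t ∈ Finset.Icc 1 (T - 1), ∑ i, ‖y (t + 1) i - S.Φ (t + 1) i (y t i)‖

/-- `E₂(t)` for a comparator sequence. -/
def E2 (S : Alg n m p) (y : ℕ → ∀ i, EuclideanSpace ℝ (Fin (p i))) (t : ℕ) : ℝ :=
  (S.α t)⁻¹ * ∑ i, (breg (S.ψ i) (S.ψ' i) (y (t - 1) i) (S.x (t - 1) i)
    - breg (S.ψ i) (S.ψ' i) (y t i) (S.x t i))

/-- `C_{1,1} = 3n²τB₁F/(1−λ) + nB₁²/2`. -/
def C11 (S : Alg n m p) : ℝ :=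
  3 * (n : ℝ) ^ 2 * S.tau * S.B1 * S.F / (1 - S.lam) + (n : ℝ) * S.B1 ^ 2 / 2

/-- `C_{1,2} = 4nG²/σ̲`. -/
def C12 (S : Alg n m p) : ℝ := 4 * (n : ℝ) * S.G ^ 2 / S.sigmin

/-- Constraint violation `‖[Σ_{t=1}^T g_t(x_t)]₊‖`. -/
def violation (S : Alg n m p) (T : ℕ) : ℝ :=
  ‖posPart (∑ t ∈ Finset.Icc 1 T, S.gsum t (S.x t))‖

end Alg

open Finset in
theorem sum_mul_sq_sub_sq_sum_mul {ι : Type*} [Fintype ι] {p y : ι → ℝ} (hsum : ∑ j, p j = 1) :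
    ∑ j, p j * y j ^ 2 - (∑ j, p j * y j) ^ 2 = ∑ j, p j * (y j - ∑ k, p k * y k) ^ 2 := by
  set μ := ∑ j, p j * y j with hμ
  have : ∑ j, p j * (y j - μ) ^ 2
      = ∑ j, p j * y j ^ 2 - 2 * μ * ∑ j, p j * y j + μ ^ 2 * ∑ j, p j := by
    simp only [mul_sum, ← sum_sub_distrib, ← sum_add_distrib]
    exact sum_congr rfl fun j _ => by ring
  rw [this, hsum, ← hμ]; ring

theorem sum_mul_sq_sub_sq_sum_mul_nonneg {ι : Type*} [Fintype ι] {p y : ι → ℝ}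
    (hp : ∀ j, 0 ≤ p j) (hsum : ∑ j, p j = 1) :
    0 ≤ ∑ j, p j * y j ^ 2 - (∑ j, p j * y j) ^ 2 := by
  rw [sum_mul_sq_sub_sq_sum_mul hsum]
  exact Finset.sum_nonneg fun j _ => mul_nonneg (hp j) (sq_nonneg _)

open Finset in
theorem half_mul_sq_sub_le_variance {ι : Type*} [Fintype ι] {p y : ι → ℝ} {w : ℝ} {a b : ι}
    (hp : ∀ j, 0 ≤ p j) (hsum : ∑ j, p j = 1) (hw : 0 ≤ w) (ha : w ≤ p a) (hb : w ≤ p b)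
    (hab : a ≠ b) :
    w / 2 * (y a - y b) ^ 2 ≤ ∑ j, p j * y j ^ 2 - (∑ j, p j * y j) ^ 2 := by
  classical
  rw [sum_mul_sq_sub_sq_sum_mul hsum]
  set μ := ∑ j, p j * y j with hμ
  have h2 : p a * (y a - μ) ^ 2 + p b * (y b - μ) ^ 2 ≤ ∑ j, p j * (y j - μ) ^ 2 := by
    rw [← sum_pair (f := fun j => p j * (y j - μ) ^ 2) hab]
    exact sum_le_sum_of_subset_of_nonneg (subset_univ _)
      fun j _ _ => mul_nonneg (hp j) (sq_nonneg _)
  have h3 := mul_le_mul_of_nonneg_right ha (sq_nonneg (y a - μ))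
  have h4 := mul_le_mul_of_nonneg_right hb (sq_nonneg (y b - μ))
  have h5 := mul_nonneg hw (sq_nonneg ((y a - μ) + (y b - μ)))
  nlinarith

open Finset in
theorem sum_sq_le_of_sum_eq_zero {n : ℕ} {x : Fin n → ℝ} {X : ℕ → ℝ} (hX : Monotone X)
    (hx : ∀ i, x i = X i) (hsum : ∑ i, x i = 0) :
    ∑ i, x i ^ 2 ≤ n ^ 2 / 4 * ∑ d ∈ range (n - 1), (X (d + 1) - X d) ^ 2 := by
  set S := ∑ d ∈ range (n - 1), (X (d + 1) - X d) ^ 2 with hS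
  have hS0 : 0 ≤ S := sum_nonneg fun _ _ => sq_nonneg _
  have hR : (X (n - 1) - X 0) ^ 2 ≤ n * S := by
    rw [← sum_range_sub]
    refine (sq_sum_le_card_mul_sum_sq (s := range (n - 1))).trans ?_
    rw [card_range]
    gcongr
    omega
  have h : 0 ≤ ∑ i, (X (n - 1) - x i) * (x i - X 0) := by
    refine sum_nonneg fun i _ => mul_nonneg ?_ ?_
    · rw [hx]; exact sub_nonneg.2 (hX (by omega))
    · rw [hx]; exact sub_nonneg.2 (hX (by omega))
  have h' : ∑ i, (X (n - 1) - x i) * (x i - X 0)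
      = (X (n - 1) + X 0) * ∑ i, x i - n * (X (n - 1) * X 0) - ∑ i, x i ^ 2 := by
    have : (n : ℝ) * (X (n - 1) * X 0) = ∑ i : Fin n, X (n - 1) * X 0 := by simp
    rw [this]
    simp only [mul_sum, ← sum_sub_distrib]
    exact sum_congr rfl fun j _ => by ring
  rw [h', hsum] at h
  have hn : (0 : ℝ) ≤ n := Nat.cast_nonneg n
  nlinarith [mul_le_mul_of_nonneg_left hR hn, mul_nonneg hn (sq_nonneg (X (n - 1) + X 0))]

open Finset in
theorem sum_gap_sq_le {X : ℕ → ℝ} (hX : Monotone X) {D : Finset ℕ} {u v : ℝ}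
    (hu : ∀ d ∈ D, u ≤ X d) (hv : ∀ d ∈ D, X (d + 1) ≤ v) :
    ∑ d ∈ D, (X (d + 1) - X d) ^ 2 ≤ (v - u) ^ 2 := by
  rcases D.eq_empty_or_nonempty with rfl | hD
  · simpa using sq_nonneg _
  have hg : ∀ d, 0 ≤ X (d + 1) - X d := fun d => sub_nonneg.2 (hX d.le_succ)
  have hle : ∑ d ∈ D, (X (d + 1) - X d) ≤ v - u := by
    calc ∑ d ∈ D, (X (d + 1) - X d)
        ≤ ∑ d ∈ Ico (D.min' hD) (D.max' hD + 1), (X (d + 1) - X d) := by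
          refine sum_le_sum_of_subset_of_nonneg (fun d hd => ?_) fun d _ _ => hg d
          exact mem_Ico.2 ⟨D.min'_le d hd, Nat.lt_succ_of_le (D.le_max' d hd)⟩
      _ = X (D.max' hD + 1) - X (D.min' hD) :=
          sum_Ico_sub X ((D.min'_le_max' hD).trans (Nat.le_succ _))
      _ ≤ v - u := sub_le_sub (hv _ (D.max'_mem hD)) (hu _ (D.min'_mem hD))
  calc ∑ d ∈ D, (X (d + 1) - X d) ^ 2 ≤ (∑ d ∈ D, (X (d + 1) - X d)) ^ 2 :=
        sum_sq_le_sq_sum_of_nonneg fun d _ => hg d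
    _ ≤ (v - u) ^ 2 := pow_le_pow_left₀ (sum_nonneg fun d _ => hg d) hle 2

open Finset in
theorem half_mul_sum_gap_sq_le_variance {n : ℕ} {X : ℕ → ℝ} (hX : Monotone X) {D : Finset ℕ}
    {p y : Fin n → ℝ} {w : ℝ} (hp : ∀ j, 0 ≤ p j) (hsum : ∑ j, p j = 1) (hw : 0 < w)
    (hpos : ∀ j, 0 < p j → w ≤ p j) {k : Fin n} (hk : 0 < p k)
    (hlow : ∀ d ∈ D, ∀ i : Fin n, (i : ℕ) ≤ d → y i ≤ X d)
    (hupp : ∀ d ∈ D, ∀ i : Fin n, d < (i : ℕ) → X (d + 1) ≤ y i)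
    (hcross : ∀ d ∈ D, ∃ j, 0 < p j ∧ ¬((k : ℕ) ≤ d ↔ (j : ℕ) ≤ d)) :
    w / 2 * ∑ d ∈ D, (X (d + 1) - X d) ^ 2
      ≤ ∑ j, p j * y j ^ 2 - (∑ j, p j * y j) ^ 2 := by
  classical
  set T : Finset (Fin n) := univ.filter fun j => 0 < p j with hT
  have hTk : k ∈ T := by simp [hT, hk]
  have hTne : T.Nonempty := ⟨k, hTk⟩
  set a := T.min' hTne with ha
  set b := T.max' hTne with hb
  have hpa : 0 < p a := by simpa [hT] using T.min'_mem hTne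
  have hpb : 0 < p b := by simpa [hT] using T.max'_mem hTne
  have hsep : ∀ d ∈ D, (a : ℕ) ≤ d ∧ d < (b : ℕ) := by
    intro d hd
    obtain ⟨j, hj, h⟩ := hcross d hd
    have hTj : j ∈ T := by simp [hT, hj]
    have h1 : (a : ℕ) ≤ k := T.min'_le k hTk
    have h2 : (k : ℕ) ≤ b := T.le_max' k hTk
    have h3 : (a : ℕ) ≤ j := T.min'_le j hTj
    have h4 : (j : ℕ) ≤ b := T.le_max' j hTj
    omega
  by_cases hab : a = b
  · have : D = ∅ := by
      refine eq_empty_of_forall_notMem fun d hd => ?_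
      have := hsep d hd
      rw [hab] at this
      omega
    subst this
    simpa using sum_mul_sq_sub_sq_sum_mul_nonneg (y := y) hp hsum
  · have h := half_mul_sq_sub_le_variance (y := y) hp hsum hw.le (hpos b hpb) (hpos a hpa)
      (Ne.symm hab)
    refine le_trans ?_ h
    gcongr
    exact sum_gap_sq_le hX (fun d hd => hlow d hd a (hsep d hd).1)
      fun d hd => hupp d hd b (hsep d hd).2

/-- A doubly stochastic matrix whose diagonal and positive entries are at least `w`. -/
structure IsMixing {ι : Type*} [Fintype ι] (w : ℝ) (A : Matrix ι ι ℝ) : Prop where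
  nonneg : ∀ i j, 0 ≤ A i j
  row : ∀ i, ∑ j, A i j = 1
  col : ∀ j, ∑ i, A i j = 1
  diag : ∀ i, w ≤ A i i
  pos : ∀ i j, 0 < A i j → w ≤ A i j

/-- The nonempty proper subsets of `ι` all have an edge leaving them among `A 0, …, A (B - 1)`. -/
def JointlyConnected {ι : Type*} (B : ℕ) (A : ℕ → Matrix ι ι ℝ) : Prop :=
  ∀ P : ι → Prop, (∃ a, P a) → (∃ b, ¬P b) → ∃ l < B, ∃ u v, P u ∧ ¬P v ∧ 0 < A l v u

namespace IsMixing

variable {ι : Type*} [Fintype ι] {w : ℝ} {A : Matrix ι ι ℝ}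

theorem sum_mulVec (hA : IsMixing w A) (y : ι → ℝ) : ∑ i, (A.mulVec y) i = ∑ i, y i := by
  simp only [Matrix.mulVec, dotProduct]
  rw [Finset.sum_comm]
  simp [← Finset.sum_mul, hA.col]

theorem sum_sq_sub_sum_sq_mulVec (hA : IsMixing w A) (y : ι → ℝ) :
    ∑ i, y i ^ 2 - ∑ i, (A.mulVec y) i ^ 2
      = ∑ i, (∑ j, A i j * y j ^ 2 - (∑ j, A i j * y j) ^ 2) := by
  have : ∑ i, ∑ j, A i j * y j ^ 2 = ∑ i, y i ^ 2 := by
    rw [Finset.sum_comm]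
    simp [← Finset.sum_mul, hA.col]
  rw [Finset.sum_sub_distrib, this]
  rfl

theorem sum_sq_mulVec_le (hA : IsMixing w A) (y : ι → ℝ) :
    ∑ i, (A.mulVec y) i ^ 2 ≤ ∑ i, y i ^ 2 := by
  rw [← sub_nonneg, hA.sum_sq_sub_sum_sq_mulVec]
  exact Finset.sum_nonneg fun i _ => sum_mul_sq_sub_sq_sum_mul_nonneg (hA.nonneg i) (hA.row i)

theorem mulVec_le (hA : IsMixing w A) {y : ι → ℝ} {i : ι} {c : ℝ}
    (h : ∀ j, 0 < A i j → y j ≤ c) : (A.mulVec y) i ≤ c := by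
  calc ∑ j, A i j * y j ≤ ∑ j, A i j * c := by
        refine Finset.sum_le_sum fun j _ => ?_
        rcases (hA.nonneg i j).eq_or_lt with h0 | h0
        · simp [← h0]
        · exact mul_le_mul_of_nonneg_left (h j h0) h0.le
    _ = c := by rw [← Finset.sum_mul, hA.row, one_mul]

theorem le_mulVec (hA : IsMixing w A) {y : ι → ℝ} {i : ι} {c : ℝ}
    (h : ∀ j, 0 < A i j → c ≤ y j) : c ≤ (A.mulVec y) i := by
  have := hA.mulVec_le (y := -y) (i := i) (c := -c) fun j hj => neg_le_neg (h j hj)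
  rw [Matrix.mulVec_neg] at this
  exact neg_le_neg_iff.1 this

open Finset in
theorem half_mul_sum_gap_sq_le {n : ℕ} {A : Matrix (Fin n) (Fin n) ℝ} (hA : IsMixing w A)
    (hw : 0 < w) {X : ℕ → ℝ} (hX : Monotone X) {D : Finset ℕ} {y : Fin n → ℝ}
    (hlow : ∀ d ∈ D, ∀ i : Fin n, (i : ℕ) ≤ d → y i ≤ X d)
    (hupp : ∀ d ∈ D, ∀ i : Fin n, d < (i : ℕ) → X (d + 1) ≤ y i)
    (hcross : ∀ d ∈ D, ∃ k j, 0 < A k j ∧ ¬((k : ℕ) ≤ d ↔ (j : ℕ) ≤ d)) :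
    w / 2 * ∑ d ∈ D, (X (d + 1) - X d) ^ 2
      ≤ ∑ i, y i ^ 2 - ∑ i, (A.mulVec y) i ^ 2 := by
  classical
  rw [hA.sum_sq_sub_sum_sq_mulVec]
  set E : Fin n → Finset ℕ := fun k =>
    D.filter fun d => ∃ j, 0 < A k j ∧ ¬((k : ℕ) ≤ d ↔ (j : ℕ) ≤ d) with hE
  have hcover : D ⊆ univ.biUnion E := by
    intro d hd
    obtain ⟨k, hk⟩ := hcross d hd
    simp only [mem_biUnion, mem_univ, true_and, hE, mem_filter]
    exact ⟨k, hd, hk⟩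
  calc w / 2 * ∑ d ∈ D, (X (d + 1) - X d) ^ 2
      ≤ w / 2 * ∑ k, ∑ d ∈ E k, (X (d + 1) - X d) ^ 2 := by
        gcongr
        calc ∑ d ∈ D, (X (d + 1) - X d) ^ 2
            ≤ ∑ d ∈ D, ∑ k, if d ∈ E k then (X (d + 1) - X d) ^ 2 else 0 := by
              refine sum_le_sum fun d hd => ?_
              obtain ⟨k, -, hk⟩ := mem_biUnion.1 (hcover hd)
              refine le_trans (by simp [hk]) (single_le_sum (fun k _ => ?_) (mem_univ k))
              split_ifs
              exacts [sq_nonneg _, le_rfl]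
          _ = ∑ k, ∑ d ∈ E k, (X (d + 1) - X d) ^ 2 := by
            rw [sum_comm]
            refine sum_congr rfl fun k _ => ?_
            rw [← sum_filter]
            refine sum_congr ?_ fun _ _ => rfl
            ext d
            simp [hE]
    _ = ∑ k, w / 2 * ∑ d ∈ E k, (X (d + 1) - X d) ^ 2 := mul_sum _ _ _
    _ ≤ _ := by
        refine sum_le_sum fun k _ => ?_
        refine half_mul_sum_gap_sq_le_variance hX (hA.nonneg k) (hA.row k) hw (hA.pos k) (k := k)
          (hw.trans_le (hA.diag k)) (fun d hd => hlow d (mem_filter.1 hd).1)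
          (fun d hd => hupp d (mem_filter.1 hd).1) fun d hd => (mem_filter.1 hd).2

end IsMixing

section Orbit

variable {n : ℕ} {w : ℝ} {A : ℕ → Matrix (Fin n) (Fin n) ℝ} {y : ℕ → Fin n → ℝ}

theorem bounds_of_uncrossed (hA : ∀ l, IsMixing w (A l)) (hy : ∀ l, y (l + 1) = (A l).mulVec (y l))
    {X : ℕ → ℝ} (hX : Monotone X) (hyX : ∀ i, y 0 i = X i) {d l : ℕ}
    (h : ∀ l' < l, ∀ k j, 0 < A l' k j → ((k : ℕ) ≤ d ↔ (j : ℕ) ≤ d)) :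
    (∀ i : Fin n, (i : ℕ) ≤ d → y l i ≤ X d) ∧
      ∀ i : Fin n, d < (i : ℕ) → X (d + 1) ≤ y l i := by
  induction l with
  | zero => exact ⟨fun i hi => by rw [hyX]; exact hX hi, fun i hi => by rw [hyX]; exact hX hi⟩
  | succ l ih =>
    obtain ⟨h1, h2⟩ := ih fun l' hl' => h l' (hl'.trans l.lt_succ_self)
    rw [hy]
    refine ⟨fun i hi => (hA l).mulVec_le fun j hj => h1 j ?_,
      fun i hi => (hA l).le_mulVec fun j hj => h2 j ?_⟩ <;>
    · have := h l l.lt_succ_self i j hj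
      omega

open Finset in
open Classical in
theorem half_mul_sum_crossed_gap_sq_le (hw : 0 < w) (hA : ∀ l, IsMixing w (A l))
    (hy : ∀ l, y (l + 1) = (A l).mulVec (y l)) {X : ℕ → ℝ} (hX : Monotone X)
    (hyX : ∀ i, y 0 i = X i) (D : Finset ℕ) (l : ℕ) :
    w / 2 * ∑ d ∈ D with ∃ l' < l, ∃ k j, 0 < A l' k j ∧ ¬((k : ℕ) ≤ d ↔ (j : ℕ) ≤ d),
        (X (d + 1) - X d) ^ 2
      ≤ ∑ i, y 0 i ^ 2 - ∑ i, y l i ^ 2 := by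
  induction l with
  | zero => simp
  | succ l ih =>
    set P : ℕ → ℕ → Prop :=
      fun l d => ∃ l' < l, ∃ k j, 0 < A l' k j ∧ ¬((k : ℕ) ≤ d ↔ (j : ℕ) ≤ d) with hP
    have hsplit : D.filter (P (l + 1)) = D.filter (P l) ∪ D.filter fun d => P (l + 1) d ∧ ¬P l d := by
      ext d
      have : P l d → P (l + 1) d := fun ⟨l', hl', h⟩ => ⟨l', hl'.trans l.lt_succ_self, h⟩
      by_cases h : P l d <;> simp [h, this]
    have hdisj : Disjoint (D.filter (P l)) (D.filter fun d => P (l + 1) d ∧ ¬P l d) := by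
      exact disjoint_filter.2 fun _ _ h h' => h'.2 h
    have hunc : ∀ d ∈ D.filter fun d => P (l + 1) d ∧ ¬P l d,
        ∀ l' < l, ∀ k j, 0 < A l' k j → ((k : ℕ) ≤ d ↔ (j : ℕ) ≤ d) := by
      intro d hd l' hl' k j hkj
      by_contra hne
      exact (mem_filter.1 hd).2.2 ⟨l', hl', k, j, hkj, hne⟩
    have hstep := (hA l).half_mul_sum_gap_sq_le hw hX (y := y l)
      (D := D.filter fun d => P (l + 1) d ∧ ¬P l d)
      (fun d hd => (bounds_of_uncrossed hA hy hX hyX (hunc d hd)).1)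
      (fun d hd => (bounds_of_uncrossed hA hy hX hyX (hunc d hd)).2) fun d hd => by
        obtain ⟨-, ⟨l', hl', k, j, hkj, hne⟩, hnP⟩ := mem_filter.1 hd
        rcases (Nat.lt_succ_iff.1 hl').eq_or_lt with rfl | hlt
        · exact ⟨k, j, hkj, hne⟩
        · exact absurd ⟨l', hlt, k, j, hkj, hne⟩ hnP
    change w / 2 * ∑ d ∈ D.filter (P (l + 1)), _ ≤ _
    change w / 2 * ∑ d ∈ D.filter (P l), _ ≤ _ at ih
    rw [hsplit, sum_union hdisj, mul_add, hy]
    linarith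

open Finset in
theorem sum_sq_block_le_of_monotone {B : ℕ} (hw : 0 < w) (hA : ∀ l, IsMixing w (A l))
    (hconn : JointlyConnected B A) (hy : ∀ l, y (l + 1) = (A l).mulVec (y l))
    (hmono : Monotone (y 0)) (hsum : ∑ i, y 0 i = 0) :
    ∑ i, y B i ^ 2 ≤ (1 - w / (2 * n ^ 2)) ^ 2 * ∑ i, y 0 i ^ 2 := by
  classical
  rcases Nat.eq_zero_or_pos n with rfl | hn
  · simp
  set X : ℕ → ℝ := fun k => y 0 ⟨min k (n - 1), by omega⟩ with hXdef
  have hX : Monotone X := fun a b hab => hmono (by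
    rw [Fin.le_def]
    exact min_le_min_right _ hab)
  have hyX : ∀ i, y 0 i = X i := fun i => by
    have : min (i : ℕ) (n - 1) = i := by omega
    simp [hXdef, this]
  have h1 := half_mul_sum_crossed_gap_sq_le hw hA hy hX hyX (range (n - 1)) B
  rw [filter_true_of_mem] at h1
  · have h2 := sum_sq_le_of_sum_eq_zero hX hyX hsum
    set S := ∑ d ∈ range (n - 1), (X (d + 1) - X d) ^ 2
    have hS : 0 ≤ ∑ i, y 0 i ^ 2 := sum_nonneg fun _ _ => sq_nonneg _
    have hn' : (0 : ℝ) < n ^ 2 := by positivity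
    have h3 : w / n ^ 2 * ∑ i, y 0 i ^ 2 ≤ w / 2 * S := by
      calc w / n ^ 2 * ∑ i, y 0 i ^ 2 ≤ w / n ^ 2 * (n ^ 2 / 4 * S) := by gcongr
        _ = w / 4 * S := by field_simp
        _ ≤ w / 2 * S := by
          have : 0 ≤ S := sum_nonneg fun _ _ => sq_nonneg _
          gcongr
          norm_num
    have h4 : w / (2 * n ^ 2) = w / n ^ 2 / 2 := by field_simp
    rw [h4]
    nlinarith [mul_nonneg (sq_nonneg (w / n ^ 2)) hS]
  · intro d hd
    have hd := mem_range.1 hd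
    obtain ⟨l, hl, u, v, hu, hv, huv⟩ := hconn (fun i => (i : ℕ) ≤ d)
      ⟨⟨0, hn⟩, Nat.zero_le d⟩ ⟨⟨n - 1, by omega⟩, hd.not_ge⟩
    exact ⟨l, hl, v, u, huv, by tauto⟩

open Finset in
theorem sum_sq_block_le {B : ℕ} (hw : 0 < w) (hA : ∀ l, IsMixing w (A l))
    (hconn : JointlyConnected B A) (hy : ∀ l, y (l + 1) = (A l).mulVec (y l))
    (hsum : ∑ i, y 0 i = 0) :
    ∑ i, y B i ^ 2 ≤ (1 - w / (2 * n ^ 2)) ^ 2 * ∑ i, y 0 i ^ 2 := by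
  set e := Tuple.sort (y 0) with he
  have key := sum_sq_block_le_of_monotone (A := fun l => (A l).submatrix e e)
    (y := fun l => y l ∘ e) (B := B) hw
    (fun l => ⟨fun i j => (hA l).nonneg _ _,
      fun i => (Equiv.sum_comp e (A l (e i))).trans ((hA l).row _),
      fun j => (Equiv.sum_comp e fun i => A l i (e j)).trans ((hA l).col _),
      fun i => (hA l).diag _, fun i j => (hA l).pos _ _⟩)
    (fun P ⟨a, ha⟩ ⟨b, hb⟩ => by
      obtain ⟨l, hl, u, v, hu, hv, huv⟩ := hconn (fun i => P (e.symm i))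
        ⟨e a, by simpa using ha⟩ ⟨e b, by simpa using hb⟩
      exact ⟨l, hl, e.symm u, e.symm v, hu, hv, by simpa using huv⟩)
    (fun l => by
      rw [hy]
      ext i
      exact (Equiv.sum_comp e fun j => A l (e i) j * y l j).symm)
    (Tuple.monotone_sort _) ((Equiv.sum_comp e (y 0)).trans hsum)
  have h1 : ∀ l, ∑ i, (y l ∘ e) i ^ 2 = ∑ i, y l i ^ 2 := fun l =>
    Equiv.sum_comp e fun i => y l i ^ 2
  rwa [h1, h1] at key

theorem sum_sq_orbit_le {B : ℕ} (hw : 0 < w) (hA : ∀ l, IsMixing w (A l))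
    (hconn : ∀ l, JointlyConnected B fun k => A (l + k))
    (hy : ∀ l, y (l + 1) = (A l).mulVec (y l)) (hsum : ∑ i, y 0 i = 0) (k : ℕ) :
    ∑ i, y k i ^ 2 ≤ ((1 - w / (2 * n ^ 2)) ^ 2) ^ (k / B) * ∑ i, y 0 i ^ 2 := by
  have hsum' : ∀ l, ∑ i, y l i = 0 := fun l => by
    induction l with
    | zero => exact hsum
    | succ l ih => rw [hy, (hA l).sum_mulVec, ih]
  have hanti : Antitone fun l => ∑ i, y l i ^ 2 :=
    antitone_nat_of_succ_le fun l => by rw [hy]; exact (hA l).sum_sq_mulVec_le _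
  have hblock : ∀ N, ∑ i, y (B * N) i ^ 2
      ≤ ((1 - w / (2 * n ^ 2)) ^ 2) ^ N * ∑ i, y 0 i ^ 2 := fun N => by
    induction N with
    | zero => simp
    | succ N ih =>
      have := sum_sq_block_le (A := fun k => A (B * N + k)) (y := fun k => y (B * N + k)) hw
        (fun l => hA _) (hconn _) (fun l => hy _) (hsum' _)
      rw [Nat.mul_succ, pow_succ', mul_assoc]
      exact this.trans (mul_le_mul_of_nonneg_left ih (sq_nonneg _))
  exact (hanti (Nat.mul_div_le k B)).trans (hblock _)

end Orbit

section Transition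

variable {n : ℕ}

/-- The product `W (s + k - 1) * ⋯ * W s`. -/
def transition (W : ℕ → Matrix (Fin n) (Fin n) ℝ) (s : ℕ) : ℕ → Matrix (Fin n) (Fin n) ℝ
  | 0 => 1
  | k + 1 => W (s + k) * transition W s k

theorem transition_col_sum {w : ℝ} {W : ℕ → Matrix (Fin n) (Fin n) ℝ}
    (hW : ∀ t, IsMixing w (W t)) (s k : ℕ) (j : Fin n) : ∑ i, transition W s k i j = 1 := by
  induction k with
  | zero => simp [transition, Matrix.one_apply]
  | succ k ih => exact ((hW (s + k)).sum_mulVec fun i => transition W s k i j).trans ih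

theorem abs_transition_sub_le {w : ℝ} {W : ℕ → Matrix (Fin n) (Fin n) ℝ} {B : ℕ} (hw : 0 < w)
    (hw1 : w < 1) (hW : ∀ t, IsMixing w (W t))
    (hconn : ∀ t, JointlyConnected B fun k => W (t + k)) (s k : ℕ) (i j : Fin n) :
    |transition W s k i j - (n : ℝ)⁻¹| ≤ (1 - w / (2 * n ^ 2)) ^ (k / B) := by
  have hn : 0 < n := i.pos
  have hn1 : (1 : ℝ) ≤ n := by exact_mod_cast hn
  have hc : 0 ≤ 1 - w / (2 * n ^ 2) := by
    rw [sub_nonneg, div_le_one (by positivity)]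
    nlinarith
  have hmean : ∑ _i : Fin n, (n : ℝ)⁻¹ = 1 := by
    rw [Finset.sum_const, Finset.card_univ, Fintype.card_fin, nsmul_eq_mul]
    exact mul_inv_cancel₀ (by positivity)
  have h0 : ∑ i, (transition W s 0 i j - (n : ℝ)⁻¹) ^ 2 ≤ 1 := by
    have : ∑ i, (transition W s 0 i j - (n : ℝ)⁻¹) ^ 2
        ≤ ∑ i, (transition W s 0 i j - (n : ℝ)⁻¹ * (2 * transition W s 0 i j - (n : ℝ)⁻¹)) := by
      refine Finset.sum_le_sum fun i _ => le_of_eq ?_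
      by_cases h : i = j <;> simp [transition, h, Matrix.one_apply] <;> ring
    refine this.trans ?_
    rw [Finset.sum_sub_distrib, ← Finset.mul_sum, Finset.sum_sub_distrib, ← Finset.mul_sum,
      transition_col_sum hW, hmean]
    have : (0 : ℝ) ≤ (n : ℝ)⁻¹ := by positivity
    linarith
  have h := sum_sq_orbit_le (A := fun l => W (s + l))
    (y := fun k i => transition W s k i j - (n : ℝ)⁻¹) (B := B) hw (fun l => hW _)
    (fun l => by simpa only [add_assoc] using hconn (s + l))
    (fun l => by
      ext i
      simp only [transition, Matrix.mul_apply, Matrix.mulVec, dotProduct, mul_sub,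
        Finset.sum_sub_distrib, ← Finset.sum_mul, (hW _).row, one_mul])
    (by rw [Finset.sum_sub_distrib, transition_col_sum hW, hmean, sub_self]) k
  refine abs_le_of_sq_le_sq' ?_ (pow_nonneg hc _) |> abs_le.2
  calc (transition W s k i j - (n : ℝ)⁻¹) ^ 2
      ≤ ∑ i, (transition W s k i j - (n : ℝ)⁻¹) ^ 2 :=
        Finset.single_le_sum (f := fun i => (transition W s k i j - (n : ℝ)⁻¹) ^ 2)
          (fun _ _ => sq_nonneg _) (Finset.mem_univ i)
    _ ≤ ((1 - w / (2 * n ^ 2)) ^ 2) ^ (k / B) * 1 :=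
        h.trans (mul_le_mul_of_nonneg_left h0 (by positivity))
    _ = ((1 - w / (2 * n ^ 2)) ^ (k / B)) ^ 2 := by rw [mul_one, pow_right_comm]

theorem norm_sum_smul_le_of_perturbed_consensus {E : Type*} [NormedAddCommGroup E]
    [NormedSpace ℝ E] {W : ℕ → Matrix (Fin n) (Fin n) ℝ} {q η : ℕ → Fin n → E} {θ ε : ℕ → ℝ}
    (hq1 : ∀ i, q 1 i = 0)
    (hq : ∀ t, 1 ≤ t → ∀ i, q (t + 1) i = θ (t + 1) • ∑ j, W t i j • q t j + η (t + 1) i)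
    (hθ : ∀ t, |θ t| ≤ 1) (hη : ∀ t, 1 ≤ t → ∀ i, ‖η t i‖ ≤ ε t) (T : ℕ) (a : Fin n → ℝ) :
    ‖∑ i, a i • q (T + 1) i‖ ≤ ∑ s ∈ Finset.Icc 1 T,
      ε (s + 1) * ∑ j, |Matrix.vecMul a (transition W (s + 1) (T - s)) j| := by
  induction T generalizing a with
  | zero => simp [hq1]
  | succ T ih =>
    have hsplit : ∑ i, a i • q (T + 1 + 1) i
        = θ (T + 1 + 1) • ∑ j, Matrix.vecMul a (W (T + 1)) j • q (T + 1) j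
          + ∑ i, a i • η (T + 1 + 1) i := by
      simp only [hq (T + 1) (by omega), smul_add, Finset.sum_add_distrib, Matrix.vecMul,
        dotProduct, Finset.sum_smul, Finset.smul_sum]
      rw [Finset.sum_comm]
      simp only [smul_smul]
      congr 1
      exact Finset.sum_congr rfl fun i _ => Finset.sum_congr rfl fun j _ => by ring_nf
    have h1 : ‖∑ i, a i • η (T + 1 + 1) i‖ ≤ ε (T + 1 + 1) * ∑ j, |a j| := by
      rw [Finset.mul_sum]
      refine norm_sum_le_of_le _ fun i _ => ?_
      rw [norm_smul, Real.norm_eq_abs, mul_comm]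
      exact mul_le_mul_of_nonneg_right (hη _ (by omega) i) (abs_nonneg _)
    have h2 : ‖θ (T + 1 + 1) • ∑ j, Matrix.vecMul a (W (T + 1)) j • q (T + 1) j‖
        ≤ ∑ s ∈ Finset.Icc 1 T,
          ε (s + 1) * ∑ j, |Matrix.vecMul a (transition W (s + 1) (T + 1 - s)) j| := by
      rw [norm_smul, Real.norm_eq_abs]
      refine (mul_le_of_le_one_left (norm_nonneg _) (hθ _)).trans ((ih _).trans_eq ?_)
      refine Finset.sum_congr rfl fun s hs => ?_
      have hs := Finset.mem_Icc.1 hs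
      rw [show T + 1 - s = T - s + 1 by omega, transition, Matrix.vecMul_vecMul,
        show s + 1 + (T - s) = T + 1 by omega]
    rw [hsplit, Finset.sum_Icc_succ_top (by omega)]
    refine (norm_add_le _ _).trans (add_le_add h2 ?_)
    simpa [transition] using h1

theorem norm_mix_sub_average_le {E : Type*} [NormedAddCommGroup E]
    [NormedSpace ℝ E] {w : ℝ} {W : ℕ → Matrix (Fin n) (Fin n) ℝ} {B : ℕ} (hw : 0 < w)
    (hw1 : w < 1) (hW : ∀ t, IsMixing w (W t))
    (hconn : ∀ t, JointlyConnected B fun k => W (t + k))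
    {q η : ℕ → Fin n → E} {θ ε : ℕ → ℝ} (hq1 : ∀ i, q 1 i = 0)
    (hq : ∀ t, 1 ≤ t → ∀ i, q (t + 1) i = θ (t + 1) • ∑ j, W t i j • q t j + η (t + 1) i)
    (hθ : ∀ t, |θ t| ≤ 1) (hη : ∀ t, 1 ≤ t → ∀ i, ‖η t i‖ ≤ ε t) (T : ℕ) (i : Fin n) :
    ‖∑ j, W (T + 1) i j • q (T + 1) j - (n : ℝ)⁻¹ • ∑ j, q (T + 1) j‖
      ≤ ∑ s ∈ Finset.Icc 1 T,
        ε (s + 1) * (n * (1 - w / (2 * n ^ 2)) ^ ((T + 1 - s) / B)) := by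
  have h := norm_sum_smul_le_of_perturbed_consensus hq1 hq hθ hη T
    fun j => W (T + 1) i j - (n : ℝ)⁻¹
  simp only [sub_smul, Finset.sum_sub_distrib, ← Finset.smul_sum] at h
  refine h.trans (Finset.sum_le_sum fun s hs => ?_)
  have hs := Finset.mem_Icc.1 hs
  refine mul_le_mul_of_nonneg_left ?_ ((norm_nonneg _).trans (hη (s + 1) (by omega) i))
  have hrow : ∀ j, Matrix.vecMul (fun j => W (T + 1) i j - (n : ℝ)⁻¹)
      (transition W (s + 1) (T - s)) j = transition W (s + 1) (T + 1 - s) i j - (n : ℝ)⁻¹ := by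
    intro j
    rw [show T + 1 - s = T - s + 1 by omega, transition,
      show s + 1 + (T - s) = T + 1 by omega]
    simp only [Matrix.vecMul, dotProduct, sub_mul, Finset.sum_sub_distrib, ← Finset.mul_sum,
      transition_col_sum hW, mul_one, Matrix.mul_apply]
  simp only [hrow]
  refine (Finset.sum_le_sum fun j _ =>
    abs_transition_sub_le hw hw1 hW hconn (s + 1) (T + 1 - s) i j).trans_eq ?_
  simp

end Transition

theorem pow_div_le_inv_sq_mul_rpow_pow {c : ℝ} (hc0 : 0 < c) (hc1 : c ≤ 1) {B : ℕ} (hB : 0 < B)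
    {k l : ℕ} (hkl : l ≤ k) : c ^ (k / B) ≤ (c ^ 2)⁻¹ * (c ^ ((B : ℝ))⁻¹) ^ l := by
  have h1 : (c ^ ((B : ℝ))⁻¹) ^ B = c := Real.rpow_inv_natCast_pow hc0.le hB.ne'
  have h2 : c ^ (k / B + 1) ≤ (c ^ ((B : ℝ))⁻¹) ^ l := by
    conv_lhs => rw [← h1, ← pow_mul]
    refine pow_le_pow_of_le_one (by positivity)
      (Real.rpow_le_one hc0.le hc1 (by positivity)) (hkl.trans ?_)
    exact (Nat.lt_mul_div_succ k hB).le
  rw [inv_mul_eq_div, le_div_iff₀ (by positivity), ← pow_add]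
  exact (pow_le_pow_of_le_one hc0.le hc1 (by omega)).trans h2

namespace Alg

variable {n m : ℕ} {p : Fin n → ℕ} (S : Alg n m p)

theorem isMixing (t : ℕ) : IsMixing S.w (S.W t) :=
  ⟨S.hWnonneg t, S.hWrow t, S.hWcol t, S.hWdiag t, S.hWpos t⟩

theorem jointlyConnected (t : ℕ) : JointlyConnected S.iota fun k => S.W (t + k) := by
  rintro P ⟨a, ha⟩ ⟨b, hb⟩
  by_contra hcon
  push Not at hcon
  have hclosed : ∀ c, Relation.ReflTransGen
      (fun u v : Fin n => ∃ l < S.iota, 0 < S.W (t + l) v u) a c → P c := by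
    intro c hc
    induction hc with
    | refl => exact ha
    | tail _ hedge ih =>
      obtain ⟨l, hl, hpos⟩ := hedge
      by_contra hP
      exact (hcon l hl _ _ ih hP).not_gt hpos
  exact hb (hclosed b (S.hconn t a b))

theorem x_mem (t : ℕ) (i : Fin n) : S.x t i ∈ S.X i := by
  rcases Nat.eq_zero_or_pos t with rfl | ht
  · exact S.hx0 i
  · rw [S.hx t ht]
    exact S.hΦmaps t i _ (S.hxtilmem t ht i)

theorem q_nonneg (t : ℕ) (i : Fin n) (j : Fin m) : 0 ≤ S.q t i j := by
  rcases Nat.eq_zero_or_pos t with rfl | ht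
  · simp [S.hq0]
  · rw [S.hq t ht]
    exact le_max_right _ _

theorem qtil_nonneg {t : ℕ} (ht : 1 ≤ t) (i : Fin n) (j : Fin m) : 0 ≤ S.qtil t i j := by
  rw [S.hqtil t ht]
  simp only [WithLp.ofLp_sum, WithLp.ofLp_smul, Finset.sum_apply, Pi.smul_apply, smul_eq_mul]
  exact Finset.sum_nonneg fun k _ => mul_nonneg (S.hWnonneg _ _ _) (S.q_nonneg _ _ _)

theorem norm_b_le {t : ℕ} (ht : 1 ≤ t) (i : Fin n) : ‖S.b t i‖ ≤ S.B1 := by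
  have hdist : ‖S.xtil t i - S.x (t - 1) i‖ ≤ S.dX :=
    (PiLp.norm_apply_le (stack (S.xtil t) - stack (S.x (t - 1))) i).trans
      (S.hdiam _ _ (S.hxtilmem t ht) (S.x_mem (t - 1)))
  rw [S.hb t ht]
  calc _ ≤ S.G * ‖S.xtil t i - S.x (t - 1) i‖ + S.F :=
        (norm_add_le _ _).trans (add_le_add (S.hGgbound _ _ _ (S.x_mem _ _) _)
          (S.hgbound _ _ _ (S.x_mem _ _)))
    _ ≤ S.G * S.dX + S.F := by
        have := S.hG
        gcongr
    _ ≤ S.B1 := by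
        rw [Alg.B1]
        linarith [S.hF]

theorem q_one (i : Fin n) : S.q 1 i = 0 := by
  have hqt : S.qtil 1 i = 0 := by simp [S.hqtil 1 le_rfl, S.hq0]
  ext j
  rw [S.hq 1 le_rfl, hqt]
  have hb : S.b 1 i j ≤ 0 := by
    have h := S.hGgsub 0 i _ (S.hx0 i) j _ (S.hxtilmem 1 le_rfl i)
    rw [S.hb 1 le_rfl]
    simpa [S.hg0, vecOf] using h
  have hγb := mul_nonpos_of_nonneg_of_nonpos (S.hγpos 1 le_rfl).le hb
  change max (0 + S.γ 1 * (S.b 1 i j - S.β 1 * 0)) 0 = 0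
  simpa using hγb

theorem norm_q_sub_le {t : ℕ} (ht : 1 ≤ t) (i : Fin n) :
    ‖S.q t i - max (1 - S.γ t * S.β t) 0 • S.qtil t i‖ ≤ S.γ t * S.B1 := by
  have hγ := S.hγpos t ht
  calc _ ≤ ‖S.γ t • S.b t i‖ := by
        refine (EuclideanSpace.norm_eq _).trans_le
          ((Real.sqrt_le_sqrt (Finset.sum_le_sum fun j _ => ?_)).trans_eq
            (EuclideanSpace.norm_eq _).symm)
        refine pow_le_pow_left₀ (norm_nonneg _) ?_ 2
        have hq : S.q t i j
            = max (S.qtil t i j + S.γ t * (S.b t i j - S.β t * S.qtil t i j)) 0 := by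
          rw [S.hq t ht]
          rfl
        have hmax : max (1 - S.γ t * S.β t) 0 * S.qtil t i j
            = max ((1 - S.γ t * S.β t) * S.qtil t i j) 0 := by
          rw [max_mul_of_nonneg _ _ (S.qtil_nonneg ht i j), zero_mul]
        simp only [WithLp.ofLp_sub, WithLp.ofLp_smul, Pi.sub_apply, Pi.smul_apply, smul_eq_mul,
          Real.norm_eq_abs]
        rw [hq, hmax]
        refine (abs_max_sub_max_le_abs _ _ _).trans_eq ?_
        ring_nf
    _ ≤ S.γ t * S.B1 := by
        rw [norm_smul, Real.norm_of_nonneg hγ.le]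
        exact mul_le_mul_of_nonneg_left (S.norm_b_le ht i) hγ.le

end Alg

theorem statement_3 {n m : ℕ} {p : Fin n → ℕ} (S : Alg n m p) :
    ∀ i : Fin n, ∀ t : ℕ, 1 ≤ t →
      ‖S.qtil (t + 1) i - S.qbar t‖ ≤
        (n : ℝ) * S.tau * S.B1 *
          ∑ s ∈ Finset.Icc 1 (t - 1), S.γ (s + 1) * S.lam ^ (t - 1 - s) := by
  intro i t ht
  obtain ⟨T, rfl⟩ : ∃ T, t = T + 1 := ⟨t - 1, by omega⟩
  have hn1 : (1 : ℝ) ≤ n := by exact_mod_cast S.hn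
  have hw := S.hw0
  have hc0 : 0 < 1 - S.w / (2 * (n : ℝ) ^ 2) := by
    rw [sub_pos, div_lt_one (by positivity)]
    nlinarith [S.hw1]
  have hc1 : 1 - S.w / (2 * (n : ℝ) ^ 2) ≤ 1 := sub_le_self _ (by positivity)
  have hB1 : 0 ≤ S.B1 := (norm_nonneg _).trans (S.norm_b_le le_rfl i)
  have h := norm_mix_sub_average_le (q := S.q)
    (η := fun t i => S.q t i - max (1 - S.γ t * S.β t) 0 • S.qtil t i)
    (θ := fun t => if 1 ≤ t then max (1 - S.γ t * S.β t) 0 else 0) (ε := fun t => S.γ t * S.B1)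
    hw S.hw1 S.isMixing S.jointlyConnected S.q_one
    (fun t _ i => by simp [S.hqtil (t + 1) (by omega)])
    (fun t => by
      split_ifs with ht
      · rw [abs_of_nonneg (le_max_right _ _)]
        exact max_le (sub_le_self _ (mul_pos (S.hγpos t ht) (S.hβpos t ht)).le) zero_le_one
      · simp)
    (fun t ht i => S.norm_q_sub_le ht i) T i
  rw [S.hqtil _ (by omega), Alg.qbar, Finset.mul_sum]
  refine h.trans (Finset.sum_le_sum fun s hs => ?_)
  have hγ := S.hγpos (s + 1) (by omega)
  calc S.γ (s + 1) * S.B1 * (n * (1 - S.w / (2 * (n : ℝ) ^ 2)) ^ ((T + 1 - s) / S.iota))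
      ≤ S.γ (s + 1) * S.B1 * (n * (S.tau * S.lam ^ (T + 1 - 1 - s))) := by
        gcongr
        exact pow_div_le_inv_sq_mul_rpow_pow hc0 hc1 S.hiota (by omega)
    _ = _ := by ring

end
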